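/- Let (e_1,…,e_n) be an orthonormal basis of V and X, Y, Z ∈ V. Then Σ_{j=1}^n tr(c̄(X)∘c̄(Y)∘c(Z)∘c(e_j)∘c̄(X)∘c̄(Y)∘c(Z)∘c(e_j)) = (n−2)·2^n·‖Z‖²·(‖X‖²‖Y‖² − 2⟨X,Y⟩²). -/

import Mathlib

open scoped RealInnerProductSpace

noncomputable section

variable {V : Type*} [NormedAddCommGroup V] [InnerProductSpace ℝ V]

/-- Left exterior multiplication `ε(v)` on the exterior algebra `ΛV`. -/
def extMul (v : V) : Module.End ℝ (ExteriorAlgebra ℝ V) :=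
  LinearMap.mulLeft ℝ (ExteriorAlgebra.ι ℝ v)

/-- Interior multiplication (contraction) `ι(v)` on the exterior algebra `ΛV`:
the unique antiderivation with `ι(v) w = ⟪v, w⟫` for `w ∈ V`. -/
def intMul (v : V) : Module.End ℝ (ExteriorAlgebra ℝ V) :=
  CliffordAlgebra.contractLeft (Q := (0 : QuadraticForm ℝ V)) (innerₛₗ ℝ v)

/-- The Clifford action `c(v) = ε(v) - ι(v)`. -/
def cl (v : V) : Module.End ℝ (ExteriorAlgebra ℝ V) := extMul v - intMul v

/-- The Clifford action `c̄(v) = ε(v) + ι(v)`. -/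
def clBar (v : V) : Module.End ℝ (ExteriorAlgebra ℝ V) := extMul v + intMul v

/-- Trace of an endomorphism of `ΛV`. -/
abbrev trΛ : Module.End ℝ (ExteriorAlgebra ℝ V) →ₗ[ℝ] ℝ :=
  LinearMap.trace ℝ (ExteriorAlgebra ℝ V)

lemma extMul_mul_extMul (v w : V) :
    extMul v * extMul w = -(extMul w * extMul v) := by
  rw [eq_neg_iff_add_eq_zero]
  refine LinearMap.ext fun x => ?_
  simp only [extMul, LinearMap.add_apply, Module.End.mul_apply, LinearMap.mulLeft_apply,
    LinearMap.zero_apply, ← mul_assoc, ← add_mul, ExteriorAlgebra.ι_add_mul_swap, zero_mul]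

lemma intMul_mul_intMul (v w : V) :
    intMul v * intMul w = -(intMul w * intMul v) :=
  LinearMap.ext fun x => CliffordAlgebra.contractLeft_comm _ _ x

lemma intMul_mul_extMul (v w : V) :
    intMul v * extMul w = ⟪v, w⟫ • 1 - extMul w * intMul v :=
  LinearMap.ext fun x => CliffordAlgebra.contractLeft_ι_mul (Q := (0 : QuadraticForm ℝ V))
    (innerₛₗ ℝ v) w x

lemma clBar_mul_clBar (v w : V) :
    clBar v * clBar w = (2 * ⟪v, w⟫) • 1 - clBar w * clBar v := by
  simp only [clBar, add_mul, mul_add, intMul_mul_extMul, extMul_mul_extMul v w,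
    intMul_mul_intMul v w, real_inner_comm v w]
  module

lemma cl_mul_cl (v w : V) : cl v * cl w = -(2 * ⟪v, w⟫) • 1 - cl w * cl v := by
  simp only [cl, sub_mul, mul_sub, intMul_mul_extMul, extMul_mul_extMul v w,
    intMul_mul_intMul v w, real_inner_comm v w]
  module

lemma cl_mul_clBar (v w : V) : cl v * clBar w = -(clBar w * cl v) := by
  simp only [cl, clBar, sub_mul, mul_sub, add_mul, mul_add, intMul_mul_extMul,
    extMul_mul_extMul v w, intMul_mul_intMul v w, real_inner_comm v w]
  module

lemma clBar_mul_self (v : V) : clBar v * clBar v = (‖v‖ ^ 2) • 1 := by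
  have h := clBar_mul_clBar v v
  rw [real_inner_self_eq_norm_sq] at h
  linear_combination (norm := module) (1 / 2 : ℝ) • h

lemma cl_mul_self (v : V) : cl v * cl v = -(‖v‖ ^ 2) • 1 := by
  have h := cl_mul_cl v v
  rw [real_inner_self_eq_norm_sq] at h
  linear_combination (norm := module) (1 / 2 : ℝ) • h

lemma commute_mul_right_of_anticommute {R : Type*} [Ring R] {a b c : R}
    (hb : a * b = -(b * a)) (hc : a * c = -(c * a)) : Commute a (b * c) := by
  rw [commute_iff_eq, ← mul_assoc, hb, neg_mul, mul_assoc, hc, mul_neg, neg_neg, mul_assoc]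

lemma commute_cl_mul_clBar_mul (u v x y : V) :
    Commute (cl u * cl v) (clBar x * clBar y) := by
  have h (w : V) : Commute (cl w) (clBar x * clBar y) :=
    commute_mul_right_of_anticommute (cl_mul_clBar w x) (cl_mul_clBar w y)
  exact (h u).mul_left (h v)

lemma clBar_mul_clBar_sq (x y : V) :
    clBar x * clBar y * (clBar x * clBar y) =
      (2 * ⟪x, y⟫) • (clBar x * clBar y) - (‖x‖ ^ 2 * ‖y‖ ^ 2) • 1 := by
  calc clBar x * clBar y * (clBar x * clBar y)
      = clBar x * (clBar y * clBar x) * clBar y := by noncomm_ring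
    _ = (2 * ⟪x, y⟫) • (clBar x * clBar y) - (clBar x * clBar x) * (clBar y * clBar y) := by
        rw [clBar_mul_clBar y x, real_inner_comm, mul_sub, sub_mul, mul_smul_comm, mul_one,
          smul_mul_assoc]
        simp only [mul_assoc]
    _ = _ := by
        rw [clBar_mul_self, clBar_mul_self, smul_mul_smul_comm, one_mul]

lemma cl_mul_cl_sq (x y : V) :
    cl x * cl y * (cl x * cl y) =
      cl x * (-(2 * ⟪y, x⟫) • cl y) - (‖x‖ ^ 2 * ‖y‖ ^ 2) • 1 := by
  calc cl x * cl y * (cl x * cl y)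
      = cl x * (cl y * cl x) * cl y := by noncomm_ring
    _ = cl x * (-(2 * ⟪y, x⟫) • cl y) - (cl x * cl x) * (cl y * cl y) := by
        rw [cl_mul_cl y x, mul_sub, sub_mul, mul_smul_comm, mul_one, mul_smul_comm,
          smul_mul_assoc]
        simp only [mul_assoc]
    _ = _ := by
        rw [cl_mul_self, cl_mul_self, smul_mul_smul_comm, one_mul, neg_mul_neg]

lemma sum_inner_smul_cl {ι : Type*} [Fintype ι] (e : OrthonormalBasis ι ℝ V) (v : V) :
    ∑ j, ⟪e j, v⟫ • cl (e j) = cl v := by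
  let f : V →ₗ[ℝ] Module.End ℝ (ExteriorAlgebra ℝ V) :=
    { toFun := cl
      map_add' := fun a b => by
        ext x
        simp [cl, extMul, intMul, add_mul]
        abel
      map_smul' := fun r a => by
        ext x
        simp [cl, extMul, intMul, smul_sub] }
  have h := congrArg f (e.sum_repr' v)
  simp only [map_sum, map_smul] at h
  exact h

lemma sum_cl_mul_cl_sq {ι : Type*} [Fintype ι] (e : OrthonormalBasis ι ℝ V) (z : V) :
    ∑ j, cl z * cl (e j) * (cl z * cl (e j)) = ((2 - Fintype.card ι) * ‖z‖ ^ 2 : ℝ) • 1 := by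
  have h : ∑ j, -(2 * ⟪e j, z⟫) • cl (e j) = (-2 : ℝ) • cl z := by
    rw [← sum_inner_smul_cl e z, Finset.smul_sum]
    exact Finset.sum_congr rfl fun j _ => by module
  simp only [cl_mul_cl_sq, OrthonormalBasis.norm_eq_one]
  rw [Finset.sum_sub_distrib, ← Finset.mul_sum, h, mul_smul_comm, cl_mul_self, Finset.sum_const,
    Finset.card_univ]
  module

lemma finrank_exteriorAlgebra {ι : Type*} [Fintype ι] [LinearOrder ι]
    (b : Module.Basis ι ℝ V) :
    Module.finrank ℝ (ExteriorAlgebra ℝ V) = 2 ^ Fintype.card ι := by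
  rw [Module.finrank_eq_card_basis b.ExteriorAlgebra, Fintype.card_finset]

lemma trace_clBar_mul_clBar (x y : V) :
    trΛ (clBar x * clBar y) = ⟪x, y⟫ * trΛ (1 : Module.End ℝ (ExteriorAlgebra ℝ V)) := by
  have h := congrArg (trΛ (V := V)) (clBar_mul_clBar x y)
  rw [map_sub, map_smul, LinearMap.trace_mul_comm ℝ (clBar y), smul_eq_mul] at h
  linarith

theorem trace_sum_cbarcbarc_XYZj [FiniteDimensional ℝ V] (n : ℕ)
    (e : OrthonormalBasis (Fin n) ℝ V) (X Y Z : V) :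
    ∑ j : Fin n,
        trΛ (clBar X ∘ₗ clBar Y ∘ₗ cl Z ∘ₗ cl (e j) ∘ₗ
              clBar X ∘ₗ clBar Y ∘ₗ cl Z ∘ₗ cl (e j))
      = ((n : ℝ) - 2) * 2 ^ n * ‖Z‖ ^ 2 * (‖X‖ ^ 2 * ‖Y‖ ^ 2 - 2 * ⟪X, Y⟫ ^ 2) := by
  have hterm (j : Fin n) :
      clBar X ∘ₗ clBar Y ∘ₗ cl Z ∘ₗ cl (e j) ∘ₗ clBar X ∘ₗ clBar Y ∘ₗ cl Z ∘ₗ cl (e j) =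
        clBar X * clBar Y * (clBar X * clBar Y) * (cl Z * cl (e j) * (cl Z * cl (e j))) := by
    rw [← (commute_cl_mul_clBar_mul Z (e j) X Y).mul_mul_mul_comm]
    simp only [← Module.End.mul_eq_comp, mul_assoc]
  have hone : trΛ (1 : Module.End ℝ (ExteriorAlgebra ℝ V)) = 2 ^ n := by
    have : Module.Free ℝ (ExteriorAlgebra ℝ V) := .of_basis e.toBasis.ExteriorAlgebra
    have : Module.Finite ℝ (ExteriorAlgebra ℝ V) := .of_basis e.toBasis.ExteriorAlgebra
    rw [LinearMap.trace_one, finrank_exteriorAlgebra e.toBasis, Fintype.card_fin]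
    norm_cast
  simp only [hterm]
  rw [← map_sum, ← Finset.mul_sum, sum_cl_mul_cl_sq, mul_smul_comm, mul_one, map_smul,
    clBar_mul_clBar_sq, map_sub, map_smul, map_smul, trace_clBar_mul_clBar, hone,
    Fintype.card_fin]
  simp only [smul_eq_mul]
  ring
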